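/- arXiv:1805.10067 — 2 statements merged into one kernel-verified Lean document; each statement's English description precedes it below -/
import Mathlib

section
/- Let K be a field and let y_i = (φ_i, ψ_i) ∈ K⟦t⟧ × K⟦u⟧ for i = 1,…,n (n ≥ 1). Set m_1 = min{ ord φ_i : i = 1,…,n } and m_2 = min{ ord ψ_i : i = 1,…,n }. Then there exists an element z of K⟦t⟧ × K⟦u⟧ which is either equal to some y_i, or equal to a sum y_i + y_j with i ≠ j, such that the first component of z has order m_1 and the second component of z has order m_2. (Thus an element of minimal valuation can always be chosen to be one of the given pairs or the sum of two of them, with no cancellation of leading terms occurring.) -/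
/-- Given pairs `y i = (φ i, ψ i)` of power series, with `m₁ = min_i ord φ_i` and
`m₂ = min_i ord ψ_i`, there is an element `z` which is either one of the `y i` or a sum
`y i + y j` with `i ≠ j`, whose first component has order `m₁` and whose second
component has order `m₂` (so an element of minimal valuation can be chosen among the
given pairs and their two-element sums, with no cancellation of leading terms). -/
theorem exists_elem_of_minimal_valuation {K : Type*} [Field K] (n : ℕ) (hn : 1 ≤ n)
    (y : Fin n → PowerSeries K × PowerSeries K) :
    ∃ z : PowerSeries K × PowerSeries K,
      ((∃ i : Fin n, z = y i) ∨ ∃ i j : Fin n, i ≠ j ∧ z = y i + y j) ∧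
      z.1.order = ⨅ i : Fin n, (y i).1.order ∧
      z.2.order = ⨅ i : Fin n, (y i).2.order := by
  haveI : Nonempty (Fin n) := ⟨⟨0, hn⟩⟩
  obtain ⟨i, hi⟩ := exists_eq_ciInf_of_finite (f := fun i : Fin n => (y i).1.order)
  obtain ⟨j, hj⟩ := exists_eq_ciInf_of_finite (f := fun i : Fin n => (y i).2.order)
  have hi' : ∀ k, (y i).1.order ≤ (y k).1.order := fun k =>
    hi.le.trans (iInf_le (fun i : Fin n => (y i).1.order) k)
  have hj' : ∀ k, (y j).2.order ≤ (y k).2.order := fun k =>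
    hj.le.trans (iInf_le (fun i : Fin n => (y i).2.order) k)
  rw [← hi, ← hj]
  by_cases h1 : (y i).2.order = (y j).2.order
  · exact ⟨y i, Or.inl ⟨i, rfl⟩, rfl, h1⟩
  by_cases h2 : (y i).1.order = (y j).1.order
  · exact ⟨y j, Or.inl ⟨j, rfl⟩, h2.symm, rfl⟩
  refine ⟨y i + y j, Or.inr ⟨i, j, fun h => h1 (by rw [h]), rfl⟩, ?_, ?_⟩
  · rw [Prod.fst_add, PowerSeries.order_add_of_order_ne _ _ h2]
    exact inf_eq_left.2 (hi' j)
  · rw [Prod.snd_add, PowerSeries.order_add_of_order_ne _ _ h1]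
    exact inf_eq_right.2 (hj' i)
end

section
/- Let M_1 and M_2 be multiplicity sequences with sum-index functions s_{M_1} and s_{M_2}. Assume that the set D = { k ≥ 1 : s_{M_1}(k) ≠ s_{M_2}(k) } is nonempty, and set k_E = min{ min(s_{M_1}(k), s_{M_2}(k)) : k ∈ D }. Then for every integer p ≥ k_E + 1 there exists an integer k̄ with 1 ≤ k̄ < p such that there exist NO integers a, b ≥ k̄ + 1 satisfying all of: M_1(k̄) = Σ_{j=k̄+1}^{a} M_1(j), M_2(k̄) = Σ_{j=k̄+1}^{b} M_2(j), and (a = b, or both a ≥ p and b ≥ p). (This is the combinatorial content of Theorem 4.2: in the multiplicity tree of a two-branch algebroid curve whose branches carry the multiplicity sequences M_1 and M_2, the highest level p_1 at which the two branches are glued satisfies p_1 ≤ k_E, because otherwise the node at level k̄ could not be obtained as a sum of the nodes of a finite subtree rooted in it.) -/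
/-!
A multiplicity sequence is a function `M : {1, 2, 3, …} → ℕ` with `M k ≥ 1` for all
`k ≥ 1` such that for every `k ≥ 1` there is an `s ≥ k + 1` with
`M k = M (k+1) + ⋯ + M s`; since the values of `M` are positive this `s` is uniquely
determined and defines the sum-index function `s_M`.  Here multiplicity sequences are
encoded as functions `ℕ → ℕ` whose relevant values are those at arguments `k ≥ 1`.
-/

/-- Uniqueness of the sum index: partial sums of positive terms are strictly monotone. -/
theorem sum_index_unique (M : ℕ → ℕ) (hM : ∀ k : ℕ, 1 ≤ k → 1 ≤ M k) (k a b : ℕ)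
    (hb : k + 1 ≤ b) (hab : a < b) :
    ∑ j ∈ Finset.Icc (k + 1) a, M j < ∑ j ∈ Finset.Icc (k + 1) b, M j := by
  apply Finset.sum_lt_sum_of_subset (i := b)
  · exact Finset.Icc_subset_Icc_right hab.le
  · simp [hb]
  · simp [hab]
  · have := hM b (by omega)
    omega
  · intros
    exact Nat.zero_le _

/-- If the set `D = {k ≥ 1 : s₁ k ≠ s₂ k}` is nonempty and
`kE = min { min (s₁ k) (s₂ k) : k ∈ D }`, then for every `p ≥ kE + 1` there is a level
`k̄` with `1 ≤ k̄ < p` at which no integers `a, b ≥ k̄ + 1` satisfy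
`M₁ k̄ = Σ_{j=k̄+1}^{a} M₁ j`, `M₂ k̄ = Σ_{j=k̄+1}^{b} M₂ j` and
(`a = b`, or both `a ≥ p` and `b ≥ p`): the branches cannot be glued up to level `p`,
i.e. `p₁ ≤ kE`. -/
theorem splitting_level_le_kE (M₁ M₂ s₁ s₂ : ℕ → ℕ)
    (hM₁pos : ∀ k : ℕ, 1 ≤ k → 1 ≤ M₁ k) (hM₂pos : ∀ k : ℕ, 1 ≤ k → 1 ≤ M₂ k)
    (hs₁ : ∀ k : ℕ, 1 ≤ k → k + 1 ≤ s₁ k ∧ M₁ k = ∑ j ∈ Finset.Icc (k + 1) (s₁ k), M₁ j)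
    (hs₂ : ∀ k : ℕ, 1 ≤ k → k + 1 ≤ s₂ k ∧ M₂ k = ∑ j ∈ Finset.Icc (k + 1) (s₂ k), M₂ j)
    (kE : ℕ)
    (hkE : IsLeast {m : ℕ | ∃ k : ℕ, 1 ≤ k ∧ s₁ k ≠ s₂ k ∧ m = min (s₁ k) (s₂ k)} kE) :
    ∀ p : ℕ, kE + 1 ≤ p →
      ∃ kbar : ℕ, 1 ≤ kbar ∧ kbar < p ∧
        ¬ ∃ a b : ℕ, kbar + 1 ≤ a ∧ kbar + 1 ≤ b ∧
          M₁ kbar = ∑ j ∈ Finset.Icc (kbar + 1) a, M₁ j ∧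
          M₂ kbar = ∑ j ∈ Finset.Icc (kbar + 1) b, M₂ j ∧
          (a = b ∨ (p ≤ a ∧ p ≤ b)) := by
  intro p hp
  obtain ⟨k, hk, hne, hmin⟩ := hkE.1
  obtain ⟨h1, e1⟩ := hs₁ k hk
  obtain ⟨h2, e2⟩ := hs₂ k hk
  refine ⟨k, hk, by omega, ?_⟩
  rintro ⟨a, b, ha, hb, ea, eb, h⟩
  have hae : a = s₁ k := by
    rcases lt_trichotomy a (s₁ k) with h' | h' | h'
    · have := sum_index_unique M₁ hM₁pos k _ _ h1 h'
      omega
    · exact h'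
    · have := sum_index_unique M₁ hM₁pos k _ _ ha h'
      omega
  have hbe : b = s₂ k := by
    rcases lt_trichotomy b (s₂ k) with h' | h' | h'
    · have := sum_index_unique M₂ hM₂pos k _ _ h2 h'
      omega
    · exact h'
    · have := sum_index_unique M₂ hM₂pos k _ _ hb h'
      omega
  omega
end
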